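/- arXiv:1606.00325 — 4 statements merged into one kernel-verified Lean document; each statement's English description precedes it below -/
import Mathlib

section
/- Let p = (p_i)_{i∈ℕ} and q = (q_i)_{i∈ℕ} be sequences of nonnegative reals with Σ_i p_i = Σ_i q_i = 1, and let H(p) = −Σ_{i∈ℕ} p_i ln p_i and H(q) = −Σ_{i∈ℕ} q_i ln q_i (with the convention 0 ln 0 = 0). If for some c ∈ (0, 1/3) one has |p_i − q_i| ≤ c·q_i for all i ∈ ℕ, then H(p) ≤ (1 + c)·H(q) + c·ln 3. -/
open MeasureTheory Filter Set
open scoped ENNReal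

noncomputable section

/-- The Shannon entropy `H(p) = -∑ᵢ pᵢ ln pᵢ` (with `0 ln 0 = 0`) of a sequence of
nonnegative reals, valued in `ℝ≥0∞` since it may be infinite. -/
def seqEntropy (p : ℕ → ℝ) : ℝ≥0∞ :=
  ∑' i, ENNReal.ofReal (Real.negMulLog (p i))

/-- If `a ≤ r * b` with `0 < a` and `0 < b ≤ 1`, then `-a ln a ≤ r * (-b ln b) + (b - a)`. -/
theorem negMulLog_le_mul_negMulLog_add_sub {a b r : ℝ} (ha : 0 < a) (hb : 0 < b) (hb1 : b ≤ 1)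
    (hab : a ≤ r * b) :
    Real.negMulLog a ≤ r * Real.negMulLog b + (b - a) := by
  have hdiv : a * Real.log (b / a) ≤ b - a := by
    calc a * Real.log (b / a) ≤ a * (b / a - 1) := by
          gcongr
          exact Real.log_le_sub_one_of_pos (div_pos hb ha)
      _ = b - a := by field_simp
  rw [Real.log_div hb.ne' ha.ne'] at hdiv
  have hlog : Real.log b ≤ 0 := Real.log_nonpos hb.le hb1
  simp only [Real.negMulLog]
  nlinarith [mul_nonneg (sub_nonneg.mpr hab) (neg_nonneg.mpr hlog)]

/-- **Lemma 1.** If `p`, `q` are probability vectors with `|pᵢ - qᵢ| ≤ c qᵢ` for all `i`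
and some `c ∈ (0, 1/3)`, then `H(p) ≤ (1 + c) H(q) + c ln 3`. -/
theorem entropy_comparison_of_close_probability_vectors
    (p q : ℕ → ℝ) (hp : ∀ i, 0 ≤ p i) (hq : ∀ i, 0 ≤ q i)
    (hps : HasSum p 1) (hqs : HasSum q 1)
    (c : ℝ) (hc0 : 0 < c) (hc3 : c < 1 / 3)
    (hpq : ∀ i, |p i - q i| ≤ c * q i) :
    seqEntropy p ≤ ENNReal.ofReal (1 + c) * seqEntropy q + ENNReal.ofReal (c * Real.log 3) := by
  have hp1 : ∀ i, p i ≤ 1 := fun i => le_hasSum hps i fun j _ => hp j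
  have hq1 : ∀ i, q i ≤ 1 := fun i => le_hasSum hqs i fun j _ => hq j
  have hηp : ∀ i, 0 ≤ Real.negMulLog (p i) := fun i => Real.negMulLog_nonneg (hp i) (hp1 i)
  have hηq : ∀ i, 0 ≤ Real.negMulLog (q i) := fun i => Real.negMulLog_nonneg (hq i) (hq1 i)
  have hpt : ∀ i, Real.negMulLog (p i) ≤ (1 + c) * Real.negMulLog (q i) + (q i - p i) := by
    intro i
    obtain ⟨hlo, hhi⟩ := abs_le.mp (hpq i)
    rcases (hq i).eq_or_lt with h0 | hpos
    · have hp0 : p i = 0 := by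
        rw [← h0] at hhi
        linarith [hp i]
      simp [hp0, ← h0]
    · exact negMulLog_le_mul_negMulLog_add_sub (by nlinarith) hpos (hq1 i) (by linarith)
  refine le_trans ?_ le_self_add
  by_cases hfin : seqEntropy q = ∞
  · rw [hfin, ENNReal.mul_top (by simp; linarith)]
    exact le_top
  have hsq : Summable fun i => Real.negMulLog (q i) := by
    simpa [ENNReal.toReal_ofReal (hηq _)] using ENNReal.summable_toReal hfin
  have hbound : HasSum (fun i => (1 + c) * Real.negMulLog (q i) + (q i - p i))
      ((1 + c) * ∑' i, Real.negMulLog (q i)) := by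
    simpa using (hsq.hasSum.mul_left (1 + c)).add (hqs.sub hps)
  have hsp : Summable fun i => Real.negMulLog (p i) :=
    Summable.of_nonneg_of_le hηp hpt hbound.summable
  unfold seqEntropy
  rw [← ENNReal.ofReal_tsum_of_nonneg hηp hsp, ← ENNReal.ofReal_tsum_of_nonneg hηq hsq,
    ← ENNReal.ofReal_mul (by linarith)]
  exact ENNReal.ofReal_le_ofReal (hasSum_le hpt hsp.hasSum hbound)
end
end

section
/- Let ζ be a countable measurable partition of a measurable space (X, 𝓕), let μ and ν be probability measures on (X, 𝓕), and let ε ∈ (0, 1/6]. If |ν(A) − μ(A)| ≤ ε·μ(A) for every atom A of ζ, then H_ν(ζ) ≤ (1 + 2ε)·H_μ(ζ) + 2ε·ln 3. (In particular, if 0 ≤ ε ≤ 1/2 and |a − b| ≤ ε·b for nonnegative reals a, b, then |a − b| ≤ 2ε·a.) -/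
open MeasureTheory Filter Set
open scoped ENNReal

noncomputable section

structure CountablePartition (X : Type*) [MeasurableSpace X] where
  atom : ℕ → Set X
  measurable_atom : ∀ i, MeasurableSet (atom i)
  disjoint_atom : Pairwise (Function.onFun Disjoint atom)
  iUnion_atom : ⋃ i, atom i = Set.univ

def partEntropy {X : Type*} [MeasurableSpace X] (μ : Measure X)
    (ξ : CountablePartition X) : ℝ≥0∞ :=
  ∑' i, ENNReal.ofReal (Real.negMulLog (μ (ξ.atom i)).toReal)

def joinAtom {X : Type*} [MeasurableSpace X] (T : X → X) (ξ : CountablePartition X)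
    (n : ℕ) (a : Fin (n + 1) → ℕ) : Set X :=
  ⋂ i : Fin (n + 1), T^[(i : ℕ)] ⁻¹' ξ.atom (a i)

def joinEntropy {X : Type*} [MeasurableSpace X] (μ : Measure X) (T : X → X)
    (ξ : CountablePartition X) (n : ℕ) : ℝ≥0∞ :=
  ∑' a : Fin (n + 1) → ℕ, ENNReal.ofReal (Real.negMulLog (μ (joinAtom T ξ n a)).toReal)

def entropyOfPartition {X : Type*} [MeasurableSpace X] (μ : Measure X) (T : X → X)
    (ξ : CountablePartition X) : ℝ≥0∞ :=
  Filter.atTop.liminf fun n : ℕ => joinEntropy μ T ξ n / ((n : ℝ≥0∞) + 1)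

def ksEntropy {X : Type*} [MeasurableSpace X] (μ : Measure X) (T : X → X) : ℝ≥0∞ :=
  ⨆ (ξ : CountablePartition X) (_ : partEntropy μ ξ < ⊤), entropyOfPartition μ T ξ

def zIter {X : Type*} (T Tinv : X → X) (i : ℤ) : X → X :=
  if 0 ≤ i then T^[i.toNat] else Tinv^[(-i).toNat]

def IsGenerator {X : Type*} [m : MeasurableSpace X] (μ : Measure X) (T Tinv : X → X)
    (ξ : CountablePartition X) : Prop :=
  ∀ B : Set X, MeasurableSet B →
    ∃ B' : Set X, MeasurableSet[MeasurableSpace.generateFrom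
        {S : Set X | ∃ (i : ℤ) (k : ℕ), S = zIter T Tinv i ⁻¹' ξ.atom k}] B' ∧
      μ (symmDiff B B') = 0

theorem negMulLog_add_self_le {p q ε : ℝ} (hp : 0 ≤ p) (hp1 : p ≤ 1) (hε : ε < 1)
    (h : |q - p| ≤ ε * p) :
    Real.negMulLog q + q ≤ (1 + ε) * Real.negMulLog p + p := by
  obtain ⟨hlow, hup⟩ := abs_le.mp h
  rcases hp.eq_or_lt with rfl | hp
  · obtain rfl : q = 0 := by linarith
    simp
  have hq : 0 < q := by nlinarith
  have hlog : Real.log (p / q) ≤ p / q - 1 := Real.log_le_sub_one_of_pos (by positivity)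
  rw [Real.log_div hp.ne' hq.ne'] at hlog
  have hmul := mul_le_mul_of_nonneg_left hlog hq.le
  have hcancel : q * (p / q - 1) = p - q := by field_simp
  have hlogp : Real.log p ≤ 0 := Real.log_nonpos hp.le hp1
  simp only [Real.negMulLog]
  nlinarith [mul_nonneg (sub_nonneg.mpr hup) (neg_nonneg.mpr hlogp)]

theorem tsum_measure_atom {X : Type*} [MeasurableSpace X] (ζ : CountablePartition X)
    (μ : Measure X) [IsProbabilityMeasure μ] : ∑' i, μ (ζ.atom i) = 1 := by
  rw [← measure_iUnion ζ.disjoint_atom ζ.measurable_atom, ζ.iUnion_atom, measure_univ]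

theorem partEntropy_le_mul {X : Type*} [MeasurableSpace X] (ζ : CountablePartition X)
    (μ ν : Measure X) [IsProbabilityMeasure μ] [IsProbabilityMeasure ν]
    {ε : ℝ} (hε0 : 0 ≤ ε) (hε : ε < 1)
    (h : ∀ i, |(ν (ζ.atom i)).toReal - (μ (ζ.atom i)).toReal| ≤ ε * (μ (ζ.atom i)).toReal) :
    partEntropy ν ζ ≤ ENNReal.ofReal (1 + ε) * partEntropy μ ζ := by
  have hle (κ : Measure X) [IsProbabilityMeasure κ] (i : ℕ) : (κ (ζ.atom i)).toReal ≤ 1 :=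
    measureReal_le_one
  have hnn (κ : Measure X) [IsProbabilityMeasure κ] (i : ℕ) :
      0 ≤ Real.negMulLog (κ (ζ.atom i)).toReal :=
    Real.negMulLog_nonneg ENNReal.toReal_nonneg (hle κ i)
  have hterm (i : ℕ) :
      ENNReal.ofReal (Real.negMulLog (ν (ζ.atom i)).toReal) + ν (ζ.atom i) ≤
        ENNReal.ofReal (1 + ε) * ENNReal.ofReal (Real.negMulLog (μ (ζ.atom i)).toReal)
          + μ (ζ.atom i) := by
    conv_lhs => rw [← ENNReal.ofReal_toReal (measure_ne_top ν (ζ.atom i))]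
    conv_rhs => rw [← ENNReal.ofReal_toReal (measure_ne_top μ (ζ.atom i))]
    simp only [ENNReal.toReal_ofReal ENNReal.toReal_nonneg]
    rw [← ENNReal.ofReal_mul (by linarith),
      ← ENNReal.ofReal_add (hnn ν i) ENNReal.toReal_nonneg,
      ← ENNReal.ofReal_add (mul_nonneg (by linarith) (hnn μ i)) ENNReal.toReal_nonneg]
    exact ENNReal.ofReal_le_ofReal
      (negMulLog_add_self_le ENNReal.toReal_nonneg (hle μ i) hε (h i))
  have hsum := ENNReal.tsum_le_tsum hterm
  rw [ENNReal.tsum_add, ENNReal.tsum_add, ENNReal.tsum_mul_left, tsum_measure_atom,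
    tsum_measure_atom] at hsum
  exact (ENNReal.add_le_add_iff_right ENNReal.one_ne_top).mp hsum

/-- If `|ν(A) - μ(A)| ≤ ε μ(A)` for every atom `A` of a countable partition `ζ` and
`ε ∈ (0, 1/6]`, then `H_ν(ζ) ≤ (1 + 2ε) H_μ(ζ) + 2ε ln 3`.  (In particular, for
nonnegative reals `a, b` and `0 ≤ ε ≤ 1/2`, `|a - b| ≤ ε b` implies `|a - b| ≤ 2ε a`.) -/
theorem partEntropy_comparison_of_close_measures
    {X : Type*} [MeasurableSpace X] (ζ : CountablePartition X)
    (μ ν : Measure X) [IsProbabilityMeasure μ] [IsProbabilityMeasure ν]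
    (ε : ℝ) (hε0 : 0 < ε) (hε6 : ε ≤ 1 / 6)
    (h : ∀ i, |(ν (ζ.atom i)).toReal - (μ (ζ.atom i)).toReal| ≤ ε * (μ (ζ.atom i)).toReal) :
    partEntropy ν ζ ≤ ENNReal.ofReal (1 + 2 * ε) * partEntropy μ ζ
        + ENNReal.ofReal (2 * ε * Real.log 3)
      ∧ ∀ a b e : ℝ, 0 ≤ a → 0 ≤ b → 0 ≤ e → e ≤ 1 / 2 →
          |a - b| ≤ e * b → |a - b| ≤ 2 * e * a := by
  refine ⟨?_, fun a b e _ hb he he2 hab => ?_⟩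
  · calc partEntropy ν ζ ≤ ENNReal.ofReal (1 + ε) * partEntropy μ ζ :=
          partEntropy_le_mul ζ μ ν hε0.le (by linarith) h
      _ ≤ ENNReal.ofReal (1 + 2 * ε) * partEntropy μ ζ := by
          gcongr
          linarith
      _ ≤ _ := le_self_add
  · have hba : b ≤ 2 * a := by nlinarith [(abs_le.mp hab).1]
    nlinarith [mul_le_mul_of_nonneg_left hba he]
end
end

section
/- Let Y = ℕ^ℤ with the cylinder σ-algebra, let τ be the right shift ((τy)_i = y_{i−1}), let ν be the Bernoulli product measure on Y determined by ν(C_k) = 2^{−k} for the cylinders C_k = {y ∈ Y : y_0 = k}, let η = {C_k : k ∈ ℕ}, and let ζ be the countable partition refining η whose atoms inside C_k are the cylinders obtained by fixing the coordinates y_j for −2^k ≤ j ≤ 0. Then for every n ∈ ℕ, the conditional entropy H_ν(ζ | ∨_{i=1}^{n} τ^{−i}ζ) is infinite. -/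
open MeasureTheory Filter Set
open scoped ENNReal

noncomputable section

/-- The sequence space `Y = ℕ^ℤ` with the cylinder (product) σ-algebra. -/
abbrev IntSeq : Type := ℤ → ℕ

/-- The right one-step shift `(τ y)ᵢ = y_{i-1}`. -/
def shift : IntSeq → IntSeq := fun y i => y (i - 1)

/-- The inverse (left) shift. -/
def shiftInv : IntSeq → IntSeq := fun y i => y (i + 1)

/-- The one-dimensional cylinder `C_k = {y : y₀ = k}`. -/
def cyl0 (k : ℕ) : Set IntSeq := {y | y 0 = k}

/-- The Bernoulli marginal `ν(C_k) = 2⁻ᵏ` for `k ≥ 1` (the symbols are the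
positive integers; the unused symbol `0` gets mass `0`). -/
def bern (k : ℕ) : ℝ≥0∞ := if k = 0 then 0 else 2⁻¹ ^ k

/-- `ν` is the Bernoulli product measure on `ℕ^ℤ` with marginals `bern`:
every finite-dimensional cylinder has product measure. -/
def IsBernoulliHalf (ν : Measure IntSeq) : Prop :=
  ∀ (F : Finset ℤ) (a : ℤ → ℕ), ν {y : IntSeq | ∀ i ∈ F, y i = a i} = ∏ i ∈ F, bern (a i)

/-- The partition `η` of `Y` into the cylinders `C_k`. -/
def etaPart : CountablePartition IntSeq where
  atom k := cyl0 k
  measurable_atom k :=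
    show MeasurableSet ((fun y : IntSeq => y 0) ⁻¹' {k}) from
      measurable_pi_apply 0 (measurableSet_singleton k)
  disjoint_atom := by
    intro k l hkl
    simp only [Function.onFun, Set.disjoint_left]
    rintro y (hy : y 0 = k) (hy' : y 0 = l)
    exact hkl (hy ▸ hy' ▸ rfl)
  iUnion_atom := by
    ext y
    simp [cyl0]

/-- Index type for the atoms of the partition `ζ`: an atom inside `C_k` is determined
by the values of the coordinates `y_j`, `-2^k ≤ j ≤ -1`. -/
abbrev ZIdx : Type := (k : ℕ) × (Fin (2 ^ k) → ℕ)

/-- The atoms of `ζ`: inside `C_k`, the cylinders obtained by fixing the coordinates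
`y_j` for `-2^k ≤ j ≤ 0` (with `y₀ = k`). -/
def zetaAtom (a : ZIdx) : Set IntSeq :=
  {y | y 0 = a.1 ∧ ∀ j : Fin (2 ^ a.1), y (-(j : ℤ) - 1) = a.2 j}

/-- Conditional entropy `H_ν(α | β) = ∑_B ν(B) H_ν(α | B)` of one countable family of
sets given another, valued in `ℝ≥0∞`. -/
def condEntPartition {Y : Type*} [MeasurableSpace Y] (ν : Measure Y)
    {ι κ : Type*} (A : ι → Set Y) (B : κ → Set Y) : ℝ≥0∞ :=
  ∑' b : κ, ν (B b) *
    ∑' a : ι, ENNReal.ofReal (Real.negMulLog ((ν (A a ∩ B b)).toReal / (ν (B b)).toReal))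

/-- Conditional entropy `H_ν(α | 𝒢)` of a countable family of sets given a σ-algebra,
via conditional expectations: `H_ν(α|𝒢) = ∑_A ∫ -E[1_A|𝒢] ln E[1_A|𝒢] dν`. -/
def condEntSigma {Y : Type*} [mY : MeasurableSpace Y] (ν : Measure Y)
    (G : MeasurableSpace Y) {ι : Type*} (A : ι → Set Y) : ℝ≥0∞ :=
  ∑' a : ι, ENNReal.ofReal
    (∫ y, Real.negMulLog ((ν[(A a).indicator (fun _ => (1 : ℝ)) | G]) y) ∂ν)

theorem bern_le_half (k : ℕ) : bern k ≤ 2⁻¹ := by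
  unfold bern
  split_ifs with h
  · exact zero_le
  · calc (2⁻¹ : ℝ≥0∞) ^ k ≤ 2⁻¹ ^ 1 :=
          pow_le_pow_right_of_le_one' (by simp) (Nat.one_le_iff_ne_zero.2 h)
      _ = 2⁻¹ := pow_one _

theorem measure_zetaAtom_le {ν : Measure IntSeq} (hbern : IsBernoulliHalf ν) (a : ZIdx) :
    ν (zetaAtom a) ≤ 2⁻¹ ^ 2 ^ a.1 := by
  rcases (zetaAtom a).eq_empty_or_nonempty with h | ⟨x, hx⟩
  · simp [h]
  have hinj : Function.Injective fun j : Fin (2 ^ a.1) => -(j : ℤ) - 1 := by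
    intro i j hij
    apply Fin.ext
    simp only at hij
    omega
  set G : Finset ℤ := Finset.univ.image fun j : Fin (2 ^ a.1) => -(j : ℤ) - 1
  have hG : G.card = 2 ^ a.1 := by
    simp [G, Finset.card_image_of_injective _ hinj]
  calc ν (zetaAtom a) ≤ ν {y | ∀ i ∈ G, y i = x i} := by
        apply measure_mono
        intro y hy i hi
        obtain ⟨j, -, rfl⟩ := Finset.mem_image.1 hi
        exact (hy.2 j).trans (hx.2 j).symm
    _ = ∏ i ∈ G, bern (x i) := hbern G x
    _ ≤ ∏ _i ∈ G, 2⁻¹ := Finset.prod_le_prod' fun i _ => bern_le_half (x i)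
    _ = 2⁻¹ ^ 2 ^ a.1 := by rw [Finset.prod_const, hG]

/-- A cylinder over coordinates other than `0` is independent of the symbol at `0`. -/
theorem measure_cyl0_inter {ν : Measure IntSeq} (hbern : IsBernoulliHalf ν) {F : Finset ℤ}
    (hF : (0 : ℤ) ∉ F) (a : ℤ → ℕ) (k : ℕ) :
    ν (cyl0 k ∩ {y | ∀ i ∈ F, y i = a i}) = bern k * ν {y | ∀ i ∈ F, y i = a i} := by
  have hne : ∀ i ∈ F, i ≠ 0 := fun i hi h => hF (h ▸ hi)
  have hset : cyl0 k ∩ {y | ∀ i ∈ F, y i = a i} =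
      {y | ∀ i ∈ insert 0 F, y i = Function.update a 0 k i} := by
    ext y
    simp only [cyl0, mem_inter_iff, mem_ofPred_eq, Finset.forall_mem_insert, Function.update_self]
    refine and_congr_right fun _ => forall₂_congr fun i hi => ?_
    rw [Function.update_of_ne (hne i hi)]
  rw [hset, hbern, hbern, Finset.prod_insert hF, Function.update_self]
  congr 1
  exact Finset.prod_congr rfl fun i hi => by rw [Function.update_of_ne (hne i hi)]

theorem cyl0_eq_iUnion_zetaAtom (k : ℕ) :
    cyl0 k = ⋃ w : Fin (2 ^ k) → ℕ, zetaAtom ⟨k, w⟩ := by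
  ext y
  simp only [cyl0, zetaAtom, mem_ofPred_eq, mem_iUnion]
  exact ⟨fun h => ⟨fun j => y (-(j : ℤ) - 1), h, fun _ => rfl⟩, fun ⟨_, h, _⟩ => h⟩

theorem mul_le_negMulLog {p q L : ℝ} (hp : 0 ≤ p) (hpq : p ≤ q) (hL : Real.log q ≤ -L) :
    p * L ≤ Real.negMulLog p := by
  rcases hp.eq_or_lt with rfl | hp
  · simp
  have := Real.log_le_log hp hpq
  rw [Real.negMulLog]
  nlinarith

theorem shift_iterate_apply (m : ℕ) (y : IntSeq) (i : ℤ) : shift^[m] y i = y (i - m) := by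
  induction m generalizing y with
  | zero => simp
  | succ m ih =>
    rw [Function.iterate_succ_apply, ih]
    simp only [shift]
    congr 1
    push_cast
    ring

/-- The entropy of `ζ` given a cylinder of positive measure not involving coordinate `0`
is infinite: each `C_k` with `k` large contributes at least `(log 2) / 2`. -/
theorem tsum_negMulLog_zetaAtom_inter_eq_top {ν : Measure IntSeq} [IsProbabilityMeasure ν]
    (hbern : IsBernoulliHalf ν) {F : Finset ℤ} (hF : (0 : ℤ) ∉ F) (a : ℤ → ℕ)
    (hB : ν {y | ∀ i ∈ F, y i = a i} ≠ 0) :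
    ∑' b : ZIdx, ENNReal.ofReal (Real.negMulLog
      ((ν (zetaAtom b ∩ {y | ∀ i ∈ F, y i = a i})).toReal /
        (ν {y | ∀ i ∈ F, y i = a i}).toReal)) = ⊤ := by
  set B : Set IntSeq := {y | ∀ i ∈ F, y i = a i}
  set c : ℝ := (ν B).toReal
  have hc : 0 < c := ENNReal.toReal_pos hB (measure_ne_top _ _)
  have hlog2 : 0 < Real.log 2 := Real.log_pos one_lt_two
  obtain ⟨K, hK⟩ := pow_unbounded_of_one_lt (-Real.log c / (Real.log 2 / 2)) one_lt_two
  rw [div_lt_iff₀ (by positivity)] at hK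
  have hblock (m : ℕ) : ENNReal.ofReal (Real.log 2 / 2) ≤
      ∑' w : Fin (2 ^ (m + (K + 1))) → ℕ, ENNReal.ofReal (Real.negMulLog
        ((ν (zetaAtom ⟨m + (K + 1), w⟩ ∩ B)).toReal / c)) := by
    set k := m + (K + 1)
    have hpow : (2 : ℝ) ^ K ≤ 2 ^ k := pow_le_pow_right₀ one_le_two (by omega)
    set L : ℝ := 2 ^ k * (Real.log 2 / 2)
    have hL : 0 ≤ L := by positivity
    have hatom (w : Fin (2 ^ k) → ℕ) :
        ν (zetaAtom ⟨k, w⟩ ∩ B) / ν B * ENNReal.ofReal L ≤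
          ENNReal.ofReal (Real.negMulLog ((ν (zetaAtom ⟨k, w⟩ ∩ B)).toReal / c)) := by
      have hp : (ν (zetaAtom ⟨k, w⟩ ∩ B)).toReal ≤ 2⁻¹ ^ 2 ^ k := by
        refine (ENNReal.toReal_mono (by finiteness)
          ((measure_mono inter_subset_left).trans (measure_zetaAtom_le hbern ⟨k, w⟩))).trans ?_
        simp
      rw [← ENNReal.ofReal_toReal (a := ν (zetaAtom ⟨k, w⟩ ∩ B) / ν B)
        (ENNReal.div_ne_top (measure_ne_top _ _) hB), ENNReal.toReal_div,
        ← ENNReal.ofReal_mul (by positivity)]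
      refine ENNReal.ofReal_le_ofReal (mul_le_negMulLog (by positivity)
        (div_le_div_of_nonneg_right hp hc.le) ?_)
      rw [Real.log_div (by positivity) hc.ne', Real.log_pow, Real.log_inv]
      push_cast
      simp only [L]
      nlinarith
    have hmass : bern k ≤ ∑' w : Fin (2 ^ k) → ℕ, ν (zetaAtom ⟨k, w⟩ ∩ B) / ν B := by
      simp only [div_eq_mul_inv]
      rw [ENNReal.tsum_mul_right, ← div_eq_mul_inv,
        ENNReal.le_div_iff_mul_le (.inl hB) (.inl (measure_ne_top _ _)),
        ← measure_cyl0_inter hbern hF, cyl0_eq_iUnion_zetaAtom, iUnion_inter]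
      exact measure_iUnion_le _
    calc ENNReal.ofReal (Real.log 2 / 2) = bern k * ENNReal.ofReal L := by
          rw [bern, if_neg (by omega), ENNReal.ofReal_mul (by positivity),
            ENNReal.ofReal_pow (by positivity), ENNReal.ofReal_ofNat, ← mul_assoc, ← mul_pow,
            ENNReal.inv_mul_cancel (by simp) (by simp), one_pow, one_mul]
      _ ≤ (∑' w : Fin (2 ^ k) → ℕ, ν (zetaAtom ⟨k, w⟩ ∩ B) / ν B) * ENNReal.ofReal L := by
          gcongr
      _ = ∑' w : Fin (2 ^ k) → ℕ, ν (zetaAtom ⟨k, w⟩ ∩ B) / ν B * ENNReal.ofReal L :=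
          ENNReal.tsum_mul_right.symm
      _ ≤ _ := ENNReal.tsum_le_tsum hatom
  rw [ENNReal.tsum_sigma', eq_top_iff]
  calc ⊤ = ∑' _ : ℕ, ENNReal.ofReal (Real.log 2 / 2) :=
        (ENNReal.tsum_const_eq_top_of_ne_zero (by simpa using hlog2)).symm
    _ ≤ _ := ENNReal.tsum_le_tsum hblock
    _ ≤ _ := ENNReal.tsum_comp_le_tsum_of_injective (add_left_injective (K + 1))
        (fun k => ∑' w : Fin (2 ^ k) → ℕ, ENNReal.ofReal (Real.negMulLog
          ((ν (zetaAtom ⟨k, w⟩ ∩ B)).toReal / c)))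

/-- **Proposition 1 (Pitskel's example).** For the Bernoulli shift `(ℕ^ℤ, ν, τ)` with
`ν(C_k) = 2⁻ᵏ` and the partition `ζ` refining `η` whose atoms inside `C_k` fix the
coordinates `y_j`, `-2^k ≤ j ≤ 0`, one has `H_ν(ζ | ∨_{i=1}^n τ⁻ⁱζ) = ∞` for every `n`. -/
theorem condEntropy_zeta_eq_top
    (ν : Measure IntSeq) [IsProbabilityMeasure ν]
    (hbern : IsBernoulliHalf ν) (hinv : MeasurePreserving shift ν ν) (n : ℕ) :
    condEntPartition ν zetaAtom
      (fun b : Fin n → ZIdx => ⋂ i : Fin n, shift^[(i : ℕ) + 1] ⁻¹' zetaAtom (b i)) = ⊤ := by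
  set F : Finset ℤ :=
    Finset.univ.image fun p : Fin n × Fin 3 => -((p.1 : ℕ) : ℤ) - 1 - ((p.2 : ℕ) : ℤ) with hFdef
  have hF : (0 : ℤ) ∉ F := by
    intro h
    obtain ⟨p, -, hp⟩ := Finset.mem_image.1 h
    omega
  have hset : (⋂ i : Fin n, shift^[(i : ℕ) + 1] ⁻¹' zetaAtom ⟨1, fun _ => 1⟩) =
      {y | ∀ i ∈ F, y i = (fun _ => 1 : ℤ → ℕ) i} := by
    ext y
    simp only [mem_iInter, mem_preimage, zetaAtom, mem_ofPred_eq, shift_iterate_apply, hFdef,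
      Finset.forall_mem_image, Finset.mem_univ, forall_true_left, Prod.forall]
    refine forall_congr' fun i => ?_
    simp [Fin.forall_fin_succ]
    ring_nf
  have hB : ν {y | ∀ i ∈ F, y i = (fun _ => 1 : ℤ → ℕ) i} ≠ 0 := by
    rw [hbern]
    simp [bern]
  refine ENNReal.tsum_eq_top_of_eq_top ⟨fun _ => ⟨1, fun _ => 1⟩, ?_⟩
  simp only [hset]
  rw [tsum_negMulLog_zetaAtom_inter_eq_top hbern hF _ hB, ENNReal.mul_top hB]
end
end

section
/- Let T be an automorphism of a measurable space (X, 𝓕), ξ a countable measurable partition of X whose atoms are numbered by positive integers, μ a T-invariant probability measure, and μ_n T-invariant probability measures. Suppose there are r_n ∈ ℕ with r_n → ∞ and ε_n > 0 with ε_n → 0 such that |μ(A) − μ_n(A)| ≤ ε_n·μ_n(A) for every atom A of ∨_{i=0}^{r_n} T^{−i}ξ and every n ≥ 1, and ξ is a generating partition for (T, μ) and each (T, μ_n). For an increasing sequence of positive integers q(m), let ξ_m be the finite partition obtained from ξ by replacing all atoms with labels ≥ q(m) by their union. Then h_μ(T) ≥ limsup_{m→∞} limsup_{n→∞} h_{μ_n}(T,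 ξ_m). (No finiteness of H_μ(ξ) is assumed.) -/
open MeasureTheory Filter Set
open scoped ENNReal

noncomputable section

/-- Shannon entropy of a finite-valued function. -/
def finiteEntropy {X ι : Type*} [MeasurableSpace X] [Fintype ι] (μ : Measure X) (f : X → ι) : ℝ :=
  ∑ i, Real.negMulLog (μ.real (f ⁻¹' {i}))

/-- The word of length `n` read by `l` along the `T`-orbit of a point. -/
def orbitWord {X α : Type*} (T : X → X) (l : X → α) (n : ℕ) (x : X) : Fin n → α :=
  fun i => l (T^[(i : ℕ)] x)

theorem negMulLog_le_sub_add {p s t : ℝ} (hp : 0 ≤ p) (hps : p ≤ s) (hpt : p ≤ t) :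
    Real.negMulLog p ≤ s * t - p - p * Real.log s - p * Real.log t := by
  rcases hp.eq_or_lt with rfl | hp
  · simpa using mul_nonneg hps hpt
  · have hs : 0 < s := hp.trans_le hps
    have ht : 0 < t := hp.trans_le hpt
    have h := Real.log_le_sub_one_of_pos (div_pos (mul_pos hs ht) hp)
    rw [Real.log_div (by positivity) hp.ne', Real.log_mul hs.ne' ht.ne'] at h
    have h2 := mul_le_mul_of_nonneg_left h hp.le
    have h3 : p * (s * t / p - 1) = s * t - p := by field_simp
    rw [h3] at h2
    unfold Real.negMulLog
    linarith

theorem sum_negMulLog_le_of_marginals {ι κ : Type*} [Fintype ι] [Fintype κ] (p : ι → κ → ℝ)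
    (hp : ∀ i j, 0 ≤ p i j) (hsum : ∑ i, ∑ j, p i j = 1) :
    ∑ i, ∑ j, Real.negMulLog (p i j) ≤
      ∑ i, Real.negMulLog (∑ j, p i j) + ∑ j, Real.negMulLog (∑ i, p i j) := by
  set s : ι → ℝ := fun i => ∑ j, p i j with hs
  set t : κ → ℝ := fun j => ∑ i, p i j with ht
  have hts : ∑ j, t j = 1 := by rw [← hsum, Finset.sum_comm]
  have h : ∑ i, ∑ j, Real.negMulLog (p i j) ≤
      ∑ i, ∑ j, (s i * t j - p i j - p i j * Real.log (s i) - p i j * Real.log (t j)) :=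
    Finset.sum_le_sum fun i _ => Finset.sum_le_sum fun j _ =>
      negMulLog_le_sub_add (hp i j)
        (Finset.single_le_sum (f := fun j => p i j) (fun j _ => hp i j) (Finset.mem_univ j))
        (Finset.single_le_sum (f := fun i => p i j) (fun i _ => hp i j) (Finset.mem_univ i))
  refine h.trans_eq ?_
  simp only [Finset.sum_sub_distrib]
  have h1 : ∑ i, ∑ j, s i * t j = 1 := by
    simp only [← Finset.mul_sum, hts, mul_one]
    exact hsum
  have h2 : ∑ i, ∑ j, p i j * Real.log (s i) = - ∑ i, Real.negMulLog (s i) := by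
    simp [← Finset.sum_mul, Real.negMulLog, hs]
  have h3 : ∑ i, ∑ j, p i j * Real.log (t j) = - ∑ j, Real.negMulLog (t j) := by
    rw [Finset.sum_comm]
    simp [← Finset.sum_mul, Real.negMulLog, ht]
  rw [h1, h2, h3, hsum]
  ring

section FiniteEntropy

variable {X ι κ : Type*} [MeasurableSpace X] [Fintype ι] [Fintype κ]

theorem sum_measureReal_inter_fiber (μ : Measure X) [IsFiniteMeasure μ] {f : X → ι}
    (hf : ∀ i, MeasurableSet (f ⁻¹' {i})) (s : Set X) :
    ∑ i, μ.real (s ∩ f ⁻¹' {i}) = μ.real s := by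
  have hdisj : Pairwise (Function.onFun Disjoint fun i => f ⁻¹' {i}) := fun i j hij =>
    Disjoint.preimage _ (by simpa using hij)
  have h := measureReal_iUnion_fintype (μ := μ.restrict s) hdisj hf
  have hu : ⋃ i, f ⁻¹' {i} = univ := by ext; simp
  rw [hu] at h
  simp only [measureReal_restrict_apply (hf _), measureReal_restrict_apply MeasurableSet.univ,
    univ_inter] at h
  simpa only [inter_comm] using h.symm

theorem finiteEntropy_prodMk_le (μ : Measure X) [IsProbabilityMeasure μ] {f : X → ι} {g : X → κ}
    (hf : ∀ i, MeasurableSet (f ⁻¹' {i})) (hg : ∀ j, MeasurableSet (g ⁻¹' {j})) :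
    finiteEntropy μ (fun x => (f x, g x)) ≤ finiteEntropy μ f + finiteEntropy μ g := by
  have hfib : ∀ i j, (fun x => (f x, g x)) ⁻¹' {(i, j)} = f ⁻¹' {i} ∩ g ⁻¹' {j} := by
    intro i j; ext; simp
  have h1 : ∀ i, ∑ j, μ.real (f ⁻¹' {i} ∩ g ⁻¹' {j}) = μ.real (f ⁻¹' {i}) :=
    fun i => sum_measureReal_inter_fiber μ hg _
  have h2 : ∀ j, ∑ i, μ.real (f ⁻¹' {i} ∩ g ⁻¹' {j}) = μ.real (g ⁻¹' {j}) := fun j => by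
    simpa only [inter_comm] using sum_measureReal_inter_fiber μ hf (g ⁻¹' {j})
  have h3 : ∑ i, μ.real (f ⁻¹' {i}) = 1 := by
    simpa using sum_measureReal_inter_fiber μ hf univ
  have h := sum_negMulLog_le_of_marginals (fun i j => μ.real (f ⁻¹' {i} ∩ g ⁻¹' {j}))
    (fun _ _ => measureReal_nonneg) (by simp only [h1, h3])
  simp only [h1, h2] at h
  simpa only [finiteEntropy, Fintype.sum_prod_type, hfib] using h

theorem finiteEntropy_equiv_comp (μ : Measure X) (e : ι ≃ κ) (f : X → ι) :
    finiteEntropy μ (fun x => e (f x)) = finiteEntropy μ f := by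
  unfold finiteEntropy
  rw [← e.sum_comp]
  refine Finset.sum_congr rfl fun i _ => ?_
  congr 2
  ext
  simp

theorem MeasureTheory.MeasurePreserving.finiteEntropy_comp {μ : Measure X} {S : X → X}
    (hS : MeasurePreserving S μ μ) {f : X → ι} (hf : ∀ i, MeasurableSet (f ⁻¹' {i})) :
    finiteEntropy μ (fun x => f (S x)) = finiteEntropy μ f := by
  unfold finiteEntropy
  refine Finset.sum_congr rfl fun i _ => ?_
  congr 1
  exact hS.measureReal_preimage (hf i).nullMeasurableSet

end FiniteEntropy

section OrbitWord

variable {X α : Type*} [MeasurableSpace X]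

theorem measurableSet_orbitWord_fiber {T : X → X} (hT : Measurable T) {l : X → α}
    (hl : ∀ a, MeasurableSet (l ⁻¹' {a})) (n : ℕ) (w : Fin n → α) :
    MeasurableSet (orbitWord T l n ⁻¹' {w}) := by
  have : orbitWord T l n ⁻¹' {w} = ⋂ i : Fin n, T^[(i : ℕ)] ⁻¹' (l ⁻¹' {w i}) := by
    ext x
    simp [orbitWord, funext_iff]
  rw [this]
  exact MeasurableSet.iInter fun i => hT.iterate i (hl _)

variable [Fintype α]

theorem finiteEntropy_orbitWord_add_le {T : X → X} {μ : Measure X} [IsProbabilityMeasure μ]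
    (hT : MeasurePreserving T μ μ) {l : X → α} (hl : ∀ a, MeasurableSet (l ⁻¹' {a})) (m n : ℕ) :
    finiteEntropy μ (orbitWord T l (m + n)) ≤
      finiteEntropy μ (orbitWord T l m) + finiteEntropy μ (orbitWord T l n) := by
  have hw := measurableSet_orbitWord_fiber hT.measurable hl
  have hsplit : orbitWord T l (m + n) =
      fun x => Fin.appendEquiv m n (orbitWord T l m x, orbitWord T l n (T^[m] x)) := by
    funext x i
    refine Fin.addCases (fun i => ?_) (fun i => ?_) i
    · simp [orbitWord, Fin.appendEquiv]
    · simp [orbitWord, Fin.appendEquiv, ← Function.iterate_add_apply, add_comm]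
  rw [hsplit, finiteEntropy_equiv_comp μ (Fin.appendEquiv m n)
    (fun x => (orbitWord T l m x, orbitWord T l n (T^[m] x)))]
  refine (finiteEntropy_prodMk_le μ (g := fun x => orbitWord T l n (T^[m] x)) (hw m)
    fun w => hT.measurable.iterate m (hw n w)).trans_eq ?_
  rw [(hT.iterate m).finiteEntropy_comp (hw n)]

theorem finiteEntropy_orbitWord_mul_le {T : X → X} {μ : Measure X} [IsProbabilityMeasure μ]
    (hT : MeasurePreserving T μ μ) {l : X → α} (hl : ∀ a, MeasurableSet (l ⁻¹' {a})) (n j : ℕ) :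
    finiteEntropy μ (orbitWord T l ((j + 1) * n)) ≤
      (j + 1) * finiteEntropy μ (orbitWord T l n) := by
  induction j with
  | zero => rw [zero_add, one_mul]; simp
  | succ j ih =>
    rw [add_mul (j + 1) 1 n, one_mul]
    refine (finiteEntropy_orbitWord_add_le hT hl _ _).trans ?_
    push_cast
    linarith

end OrbitWord

section Label

variable {X : Type*} [MeasurableSpace X]

theorem CountablePartition.exists_label (ξ : CountablePartition X) :
    ∃ L : X → ℕ, ∀ i, ξ.atom i = L ⁻¹' {i} := by
  have h : ∀ x, ∃ i, x ∈ ξ.atom i := fun x => by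
    rw [← mem_iUnion, ξ.iUnion_atom]
    trivial
  choose L hL using h
  refine ⟨L, fun i => ?_⟩
  ext x
  refine ⟨fun hx => ?_, fun hx => ?_⟩
  · by_contra hne
    exact (ξ.disjoint_atom hne).ne_of_mem (hL x) hx rfl
  · rw [mem_preimage, mem_singleton_iff] at hx
    exact hx ▸ hL x

theorem joinAtom_eq_orbitWord_fiber (T : X → X) {ξ : CountablePartition X} {L : X → ℕ}
    (hL : ∀ i, ξ.atom i = L ⁻¹' {i}) (n : ℕ) (a : Fin (n + 1) → ℕ) :
    joinAtom T ξ n a = orbitWord T L (n + 1) ⁻¹' {a} := by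
  ext x
  simp [joinAtom, hL, orbitWord, funext_iff]

theorem partEntropy_lt_top {ξ : CountablePartition X} {N : ℕ} (hξ : ∀ i, N ≤ i → ξ.atom i = ∅)
    (μ : Measure X) : partEntropy μ ξ < ⊤ := by
  have h : partEntropy μ ξ =
      ∑ i ∈ Finset.range N, ENNReal.ofReal (Real.negMulLog (μ (ξ.atom i)).toReal) := by
    refine tsum_eq_sum fun i hi => ?_
    rw [hξ i (by simpa using hi)]
    simp
  rw [h]
  exact ENNReal.sum_lt_top.2 fun i _ => ENNReal.ofReal_lt_top

theorem joinEntropy_eq_finiteEntropy (μ : Measure X) [IsProbabilityMeasure μ] (T : X → X)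
    {ξ : CountablePartition X} {N : ℕ} {l : X → Fin N}
    (hl : ∀ i, ξ.atom i = {x | (l x : ℕ) = i}) (n : ℕ) :
    joinEntropy μ T ξ n = ENNReal.ofReal (finiteEntropy μ (orbitWord T l (n + 1))) := by
  let e : (Fin (n + 1) → Fin N) → (Fin (n + 1) → ℕ) := fun w i => w i
  have he : Function.Injective e := fun v w h => by
    funext i
    exact Fin.ext (congrFun h i)
  have hfib : ∀ a, joinAtom T ξ n a = {x | e (orbitWord T l (n + 1) x) = a} := fun a => by
    ext x
    simp [joinAtom, hl, e, orbitWord, funext_iff]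
  have hsupp : Function.support
      (fun a => ENNReal.ofReal (Real.negMulLog (μ (joinAtom T ξ n a)).toReal)) ⊆ range e := by
    intro a ha
    by_contra hne
    refine ha ?_
    have : joinAtom T ξ n a = ∅ := by
      rw [hfib]
      ext x
      simp only [mem_ofPred_eq, mem_empty_iff_false, iff_false]
      exact fun h => hne ⟨_, h⟩
    simp [this]
  rw [joinEntropy, ← he.tsum_eq hsupp, tsum_fintype, finiteEntropy, ENNReal.ofReal_sum_of_nonneg
    fun _ _ => Real.negMulLog_nonneg measureReal_nonneg measureReal_le_one]
  refine Finset.sum_congr rfl fun w _ => ?_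
  rw [hfib]
  simp only [he.eq_iff]
  rfl

theorem entropyOfPartition_le_joinEntropy_div (μ : Measure X) [IsProbabilityMeasure μ]
    {T : X → X} (hT : MeasurePreserving T μ μ) {ξ : CountablePartition X} {N : ℕ} {l : X → Fin N}
    (hl : ∀ i, ξ.atom i = {x | (l x : ℕ) = i}) (k : ℕ) :
    entropyOfPartition μ T ξ ≤ joinEntropy μ T ξ k / ((k : ℝ≥0∞) + 1) := by
  have hlm : ∀ a, MeasurableSet (l ⁻¹' {a}) := fun a => by
    have : l ⁻¹' {a} = ξ.atom a := by
      ext x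
      simp [hl, Fin.ext_iff]
    exact this ▸ ξ.measurable_atom a
  refine liminf_le_of_frequently_le' (frequently_atTop.2 fun j => ?_)
  refine ⟨(j + 1) * (k + 1) - 1, ?_, ?_⟩
  · have : (j + 1) * 1 ≤ (j + 1) * (k + 1) := Nat.mul_le_mul_left _ (by omega)
    omega
  · have hpos : 0 < (j + 1) * (k + 1) := by positivity
    have hn : (j + 1) * (k + 1) - 1 + 1 = (j + 1) * (k + 1) := Nat.sub_add_cancel hpos
    have hc : (((j + 1) * (k + 1) - 1 : ℕ) : ℝ≥0∞) + 1 = ((j : ℝ≥0∞) + 1) * (k + 1) := by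
      exact_mod_cast hn
    rw [joinEntropy_eq_finiteEntropy μ T hl, joinEntropy_eq_finiteEntropy μ T hl, hn, hc]
    have h := ENNReal.ofReal_le_ofReal (finiteEntropy_orbitWord_mul_le hT hlm (k + 1) j)
    rw [ENNReal.ofReal_mul (by positivity), ENNReal.ofReal_add (by positivity) zero_le_one,
      ENNReal.ofReal_natCast, ENNReal.ofReal_one] at h
    refine (ENNReal.div_le_div_right h _).trans_eq ?_
    exact ENNReal.mul_div_mul_left _ _ (by simp) (by finiteness)

end Label

theorem abs_measureReal_sub_le_of_fiber {X ι : Type*} [MeasurableSpace X] [Countable ι]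
    (μ ν : Measure X) [IsProbabilityMeasure μ] [IsProbabilityMeasure ν] {f : X → ι}
    (hf : ∀ i, MeasurableSet (f ⁻¹' {i})) {ε : ℝ}
    (h : ∀ i, |μ.real (f ⁻¹' {i}) - ν.real (f ⁻¹' {i})| ≤ ε * ν.real (f ⁻¹' {i})) (s : Set ι) :
    |μ.real (f ⁻¹' s) - ν.real (f ⁻¹' s)| ≤ ε * ν.real (f ⁻¹' s) := by
  have hsum : ∀ ρ : Measure X, IsProbabilityMeasure ρ →
      HasSum (fun i : s => ρ.real (f ⁻¹' {(i : ι)})) (ρ.real (f ⁻¹' s)) := by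
    intro ρ _
    have hu : f ⁻¹' s = ⋃ i : s, f ⁻¹' {(i : ι)} := by ext; simp
    rw [hu]
    have hdisj : Pairwise (Function.onFun Disjoint fun i : s => f ⁻¹' {(i : ι)}) :=
      fun i j hij => Disjoint.preimage _ (by simpa [Subtype.ext_iff] using hij)
    rw [measureReal_def, measure_iUnion hdisj fun i => hf i,
      ENNReal.tsum_toReal_eq fun i => measure_ne_top _ _]
    refine ENNReal.hasSum_toReal ?_
    rw [← measure_iUnion hdisj fun i => hf i]
    exact measure_ne_top _ _
  have hμ := hsum μ inferInstance
  have hν := hsum ν inferInstance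
  rw [abs_le]
  constructor
  · have := hasSum_le (fun i : s => (abs_le.1 (h i)).1) (hν.mul_left ε).neg (hμ.sub hν)
    exact this
  · exact hasSum_le (fun i : s => (abs_le.1 (h i)).2) (hμ.sub hν) (hν.mul_left ε)

/-- Entropies of words in the merged labels converge, because every cylinder of the merged
partition is a countable union of cylinders of the original one. -/
theorem tendsto_finiteEntropy_orbitWord {X α : Type*} [MeasurableSpace X] [Fintype α]
    {T : X → X} (hT : Measurable T) {L : X → ℕ} (hL : ∀ i, MeasurableSet (L ⁻¹' {i}))
    (c : ℕ → α) (μ : Measure X) [IsProbabilityMeasure μ] (μseq : ℕ → Measure X)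
    (hprob : ∀ n, 1 ≤ n → IsProbabilityMeasure (μseq n)) {r : ℕ → ℕ} {ε : ℕ → ℝ}
    (hr : Tendsto r atTop atTop) (hεpos : ∀ n, 0 < ε n) (hεlim : Tendsto ε atTop (nhds 0))
    (hclose : ∀ n, 1 ≤ n → ∀ a : Fin (r n + 1) → ℕ,
      |μ.real (orbitWord T L (r n + 1) ⁻¹' {a}) - (μseq n).real (orbitWord T L (r n + 1) ⁻¹' {a})|
        ≤ ε n * (μseq n).real (orbitWord T L (r n + 1) ⁻¹' {a})) (k : ℕ) :
    Tendsto (fun n => finiteEntropy (μseq n) (orbitWord T (fun x => c (L x)) k)) atTop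
      (nhds (finiteEntropy μ (orbitWord T (fun x => c (L x)) k))) := by
  refine tendsto_finsetSum _ fun w _ => (Real.continuous_negMulLog.tendsto _).comp ?_
  rw [tendsto_iff_dist_tendsto_zero]
  refine squeeze_zero' (Eventually.of_forall fun _ => dist_nonneg) ?_ hεlim
  filter_upwards [eventually_ge_atTop 1, hr.eventually_ge_atTop k] with n hn hrn
  have := hprob n hn
  have hset : orbitWord T (fun x => c (L x)) k ⁻¹' {w} = orbitWord T L (r n + 1) ⁻¹'
      {a | ∀ i : Fin k, c (a ⟨i, by omega⟩) = w i} := by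
    ext x
    simp [orbitWord, funext_iff]
  rw [dist_comm, Real.dist_eq, hset]
  refine (abs_measureReal_sub_le_of_fiber μ (μseq n)
    (measurableSet_orbitWord_fiber hT hL (r n + 1)) (hclose n hn) _).trans ?_
  exact mul_le_of_le_one_right (hεpos n).le measureReal_le_one

/-- **Theorem 2.** Under the hypotheses of Theorem 1 except the finiteness of `H_μ(ξ)`,
if `ξₘ` denotes the finite partition obtained from `ξ` by merging all atoms with labels
`≥ q(m)` into a single atom (for an increasing sequence `q(m)` of positive integers), then
`h_μ(T) ≥ limsup_m limsup_n h_{μₙ}(T, ξₘ)`. -/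
theorem entropy_lower_bound_via_truncated_partitions
    {X : Type*} [MeasurableSpace X] (T Tinv : X → X)
    (hT : Measurable T) (hTinv : Measurable Tinv)
    (hleft : Function.LeftInverse Tinv T) (hright : Function.RightInverse Tinv T)
    (ξ : CountablePartition X)
    (μ : Measure X) [IsProbabilityMeasure μ] (hμinv : MeasurePreserving T μ μ)
    (μseq : ℕ → Measure X)
    (hprob : ∀ n, 1 ≤ n → IsProbabilityMeasure (μseq n))
    (hinv : ∀ n, 1 ≤ n → MeasurePreserving T (μseq n) (μseq n))
    (r : ℕ → ℕ) (ε : ℕ → ℝ)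
    (hr : Tendsto r atTop atTop)
    (hεpos : ∀ n, 0 < ε n) (hεlim : Tendsto ε atTop (nhds 0))
    (hclose : ∀ n, 1 ≤ n → ∀ a : Fin (r n + 1) → ℕ,
      |(μ (joinAtom T ξ (r n) a)).toReal - (μseq n (joinAtom T ξ (r n) a)).toReal|
        ≤ ε n * (μseq n (joinAtom T ξ (r n) a)).toReal)
    (hgen : IsGenerator μ T Tinv ξ)
    (hgenseq : ∀ n, 1 ≤ n → IsGenerator (μseq n) T Tinv ξ)
    (q : ℕ → ℕ) (hq : StrictMono q) (hqpos : ∀ m, 0 < q m)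
    (ξm : ℕ → CountablePartition X)
    (hξm : ∀ m i, (ξm m).atom i =
      if i < q m then ξ.atom i
      else if i = q m then ⋃ j : ℕ, ⋃ (_ : q m ≤ j), ξ.atom j
      else ∅) :
    Filter.atTop.limsup
        (fun m => Filter.atTop.limsup (fun n => entropyOfPartition (μseq n) T (ξm m)))
      ≤ ksEntropy μ T := by
  obtain ⟨L, hL⟩ := ξ.exists_label
  have hLm : ∀ i, MeasurableSet (L ⁻¹' {i}) := fun i => hL i ▸ ξ.measurable_atom i
  refine limsup_le_of_le (by isBoundedDefault) (Eventually.of_forall fun m => ?_)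
  let c : ℕ → Fin (q m + 1) := fun j => ⟨min j (q m), by omega⟩
  have hl : ∀ i, (ξm m).atom i = {x | (c (L x) : ℕ) = i} := by
    intro i
    ext x
    rw [hξm]
    split_ifs with h1 h2
    · simp only [hL, c, mem_preimage, mem_singleton_iff, mem_ofPred_eq]
      omega
    · simp only [hL, c, mem_iUnion, mem_preimage, mem_singleton_iff, mem_ofPred_eq, exists_prop,
        exists_eq_right']
      omega
    · simp only [c, mem_empty_iff_false, mem_ofPred_eq, false_iff]
      omega
  have hfin : partEntropy μ (ξm m) < ⊤ := by
    refine partEntropy_lt_top (N := q m + 1) (fun i hi => ?_) μ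
    rw [hξm, if_neg (by omega), if_neg (by omega)]
  refine le_trans ?_ (le_iSup₂ (f := fun ζ (_ : partEntropy μ ζ < ⊤) => entropyOfPartition μ T ζ)
    (ξm m) hfin)
  refine le_liminf_of_le (by isBoundedDefault) (Eventually.of_forall fun k => ?_)
  have hlim : Tendsto (fun n => ENNReal.ofReal
      (finiteEntropy (μseq n) (orbitWord T (fun x => c (L x)) (k + 1))) / ((k : ℝ≥0∞) + 1)) atTop
      (nhds (joinEntropy μ T (ξm m) k / ((k : ℝ≥0∞) + 1))) := by
    rw [joinEntropy_eq_finiteEntropy μ T hl]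
    refine ENNReal.Tendsto.div_const (ENNReal.tendsto_ofReal ?_) (Or.inr (by simp))
    refine tendsto_finiteEntropy_orbitWord hT hLm c μ μseq hprob hr hεpos hεlim ?_ (k + 1)
    intro n hn a
    rw [← joinAtom_eq_orbitWord_fiber T hL]
    exact hclose n hn a
  rw [← hlim.limsup_eq]
  refine limsup_le_limsup ?_
  filter_upwards [eventually_ge_atTop 1] with n hn
  have := hprob n hn
  rw [← joinEntropy_eq_finiteEntropy (μseq n) T hl]
  exact entropyOfPartition_le_joinEntropy_div (μseq n) (hinv n hn) hl k
end
end
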